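/- Let p be an odd prime and let μ ⊆ λ be partitions. Let G = ⊕_{i=1}^{l(λ)} ℤ/p^{λ_i}ℤ and T = ⊕_{j=1}^{l(μ)} ℤ/p^{μ_j}ℤ. Then the number of subgroups H of G with H isomorphic to T equals p^{n(λ) − n(μ)} · sk_{λ/μ}(p^{−1}), as an equality of rational numbers. -/

import Mathlib

open scoped BigOperators Classical

namespace EK

/-- Conjugate partition: `conj f j = #{i : f i ≥ j}` (parts of `f` are `f 0, f 1, …`,
i.e. `f i = λ_{i+1}`). -/
noncomputable def conj (f : ℕ → ℕ) (j : ℕ) : ℕ := Nat.card {i : ℕ // j ≤ f i}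

/-- `f` represents a partition: weakly decreasing with finitely many nonzero parts. -/
def IsPartition (f : ℕ → ℕ) : Prop := Antitone f ∧ ∃ N, ∀ i, N ≤ i → f i = 0

/-- `l(f) = n`: the first `n` parts are positive, the rest vanish. -/
def HasLength (f : ℕ → ℕ) (n : ℕ) : Prop := (∀ i < n, 0 < f i) ∧ ∀ i, n ≤ i → f i = 0

/-- `|λ| = Σ_i λ_i`. -/
noncomputable def psize (f : ℕ → ℕ) : ℕ := ∑ᶠ i, f i

/-- `n(λ) = Σ_{i ≥ 1} (i-1) λ_i` (0-indexed: `Σ_i i * f i`). -/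
noncomputable def nstat (f : ℕ → ℕ) : ℕ := ∑ᶠ i, i * f i

/-- `φ_r(u) = ∏_{i=1}^r (1 - u^i)`. -/
def phiPoch {F : Type*} [Field F] (u : F) (r : ℕ) : F := ∏ i ∈ Finset.Icc 1 r, (1 - u ^ i)

/-- Gaussian binomial `binom(a,b)_u = φ_a(u)/(φ_b(u) φ_{a-b}(u))` for `0 ≤ b ≤ a`, `0` otherwise. -/
noncomputable def gauss {F : Type*} [Field F] (u : F) (a b : ℤ) : F :=
  if 0 ≤ b ∧ b ≤ a then phiPoch u a.toNat / (phiPoch u b.toNat * phiPoch u (a - b).toNat)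
  else 0

/-- `sk_{λ/μ}(u) = u^{Σ_{j≥1} C(λ'_j - μ'_j, 2)} ∏_{j≥1} binom(λ'_j - μ'_{j+1}, m_j(μ))_u`
(the factors for `j > λ_1` are all `1` and the exponents vanish there, so the product and
sum are taken over `1 ≤ j ≤ λ_1 = f 0`). -/
noncomputable def sk {F : Type*} [Field F] (u : F) (f g : ℕ → ℕ) : F :=
  u ^ (∑ j ∈ Finset.Icc 1 (f 0), Nat.choose (conj f j - conj g j) 2) *
    ∏ j ∈ Finset.Icc 1 (f 0),
      gauss u ((conj f j : ℤ) - (conj g (j + 1) : ℤ)) ((conj g j : ℤ) - (conj g (j + 1) : ℤ))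

/-- `μ ⊆ λ` and `λ/μ` is a horizontal strip, i.e. `λ'_j - μ'_j ∈ {0,1}` for all `j ≥ 1`. -/
def IsHStrip (f g : ℕ → ℕ) : Prop :=
  (∀ i, g i ≤ f i) ∧ ∀ j, 1 ≤ j → conj f j ≤ conj g j + 1

/-- `φ_{λ/μ}(u) = ∏_{j ≥ 1, λ'_j = μ'_j + 1, λ'_{j+1} = μ'_{j+1}} (1 - u^{m_j(λ)})` if `λ/μ` is
a horizontal strip, and `0` otherwise (factors with `j > λ_1` never occur). -/
noncomputable def phiStrip {F : Type*} [Field F] (u : F) (f g : ℕ → ℕ) : F :=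
  if IsHStrip f g then
    ∏ j ∈ (Finset.Icc 1 (f 0)).filter
        (fun j => conj f j = conj g j + 1 ∧ conj f (j + 1) = conj g (j + 1)),
      (1 - u ^ (conj f j - conj f (j + 1)))
  else 0

/-- `b_λ(u) = ∏_{i ≥ 1} φ_{m_i(λ)}(u)` (factors with `i > λ_1` are `1`). -/
noncomputable def bcoef {F : Type*} [Field F] (u : F) (f : ℕ → ℕ) : F :=
  ∏ i ∈ Finset.Icc 1 (f 0), phiPoch u (conj f i - conj f (i + 1))

section Torsion

/-- Every nonzero element of `ℤ/p^(k+1)` has `p^k` as a multiple. -/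
lemma exists_zsmul_eq_prime_pow {p : ℕ} (hp : p.Prime) (k : ℕ) {z : ZMod (p ^ (k + 1))}
    (hz : z ≠ 0) : ∃ c : ℤ, c • z = (p : ZMod (p ^ (k + 1))) ^ k := by
  have : NeZero (p ^ (k + 1)) := ⟨(pow_pos hp.pos _).ne'⟩
  obtain ⟨v, hv, hgcd⟩ := (Nat.dvd_prime_pow hp).1 (Nat.gcd_dvd_right z.val (p ^ (k + 1)))
  have hvk : v ≤ k := by
    by_contra h
    obtain rfl : v = k + 1 := by omega
    apply hz
    rw [← ZMod.natCast_zmod_val z, ZMod.natCast_eq_zero_iff]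
    exact Nat.gcd_eq_right_iff_dvd.1 hgcd
  have hbez := congrArg (Int.cast : ℤ → ZMod (p ^ (k + 1)))
    (Nat.gcd_eq_gcd_ab z.val (p ^ (k + 1)))
  rw [hgcd] at hbez
  have hzero : (p : ZMod (p ^ (k + 1))) ^ (k + 1) = 0 := by
    exact_mod_cast ZMod.natCast_self (p ^ (k + 1))
  push_cast at hbez
  rw [hzero, zero_mul, add_zero, ZMod.natCast_zmod_val] at hbez
  refine ⟨p ^ (k - v) * Nat.gcdA z.val (p ^ (k + 1)), ?_⟩
  rw [zsmul_eq_mul]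
  push_cast
  rw [mul_assoc, mul_comm _ z, ← hbez, ← pow_add]
  congr 1
  omega

lemma card_torsion_zmod (p a k : ℕ) (hp : p.Prime) :
    Nat.card {x : ZMod (p ^ a) // p ^ k • x = 0} = p ^ min k a := by
  have : NeZero (p ^ a) := ⟨(pow_pos hp.pos _).ne'⟩
  have h := IsAddCyclic.card_nsmulAddMonoidHom_ker (G := ZMod (p ^ a)) (p ^ k)
  rw [Nat.card_zmod, Nat.gcd_comm] at h
  have hgcd : (p ^ k).gcd (p ^ a) = p ^ min k a := by
    rcases le_total k a with hka | hka
    · rw [min_eq_left hka, Nat.gcd_eq_left (pow_dvd_pow p hka)]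
    · rw [min_eq_right hka, Nat.gcd_eq_right (pow_dvd_pow p hka)]
  rw [hgcd] at h
  exact h

lemma card_torsion_pi {p : ℕ} (hp : p.Prime) (n : ℕ) (f : ℕ → ℕ) (k : ℕ) :
    Nat.card {x : ∀ i : Fin n, ZMod (p ^ f i) // p ^ k • x = 0} =
      p ^ ∑ i ∈ Finset.range n, min k (f i) := by
  have e : {x : ∀ i : Fin n, ZMod (p ^ f i) // p ^ k • x = 0} ≃
      ∀ i : Fin n, {x : ZMod (p ^ f i) // p ^ k • x = 0} :=
    (Equiv.subtypeEquivRight fun x => funext_iff).trans (Equiv.subtypePiEquivPi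
      (p := fun {i : Fin n} (x : ZMod (p ^ f i)) => p ^ k • x = 0))
  rw [Nat.card_congr e, Nat.card_pi, ← Finset.prod_pow_eq_pow_sum, Finset.prod_range]
  exact Finset.prod_congr rfl fun i _ => card_torsion_zmod p (f i) k hp

/-- In `ℤ/p^a` with `k < a`, every element of order dividing `p` is divisible by `p^k`. -/
lemma exists_pow_nsmul_eq_zmod {p a k : ℕ} (hp : p.Prime) (hk : k < a) (z : ZMod (p ^ a))
    (hz : p • z = 0) : ∃ s : ZMod (p ^ a), p ^ k • s = z := by
  have : NeZero (p ^ a) := ⟨(pow_pos hp.pos _).ne'⟩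
  have hdvd : p ^ a ∣ p * z.val := by
    rw [← ZMod.natCast_eq_zero_iff]
    push_cast
    rw [ZMod.natCast_zmod_val, ← nsmul_eq_mul, hz]
  obtain ⟨b, rfl⟩ : ∃ b, a = b + 1 := ⟨a - 1, by omega⟩
  have hdvd' : p ^ b ∣ z.val :=
    (Nat.mul_dvd_mul_iff_left hp.pos).1 ((pow_succ' p b).symm.dvd.trans hdvd)
  obtain ⟨c, hc⟩ := (pow_dvd_pow p (show k ≤ b by omega)).trans hdvd'
  refine ⟨c, ?_⟩
  rw [nsmul_eq_mul, ← Nat.cast_mul, ← hc, ZMod.natCast_zmod_val]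

lemma exists_pow_nsmul_eq_pi {p k m : ℕ} (hp : p.Prime) {g : ℕ → ℕ} (hk : ∀ j < m, k < g j)
    (t : ∀ j : Fin m, ZMod (p ^ g j)) (ht : p • t = 0) :
    ∃ s : ∀ j : Fin m, ZMod (p ^ g j), p ^ k • s = t := by
  choose s hs using fun j : Fin m =>
    exists_pow_nsmul_eq_zmod hp (hk j j.2) (t j) (congrFun ht j)
  exact ⟨s, funext hs⟩

end Torsion

section InjectiveHoms

variable {T U G : Type*} [AddCommGroup T] [AddCommGroup U] [AddCommGroup G]

/-- Counting the admissible images of a new cyclic generator of order `p^(k+1)`. -/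
lemma card_extension_add (p k : ℕ) [Finite T] [Finite G]
    (hdiv : ∀ t : T, p • t = 0 → ∃ s : T, p ^ k • s = t)
    (φ : T →+ G) (hφ : Function.Injective φ) :
    Nat.card {x : G // p ^ (k + 1) • x = 0 ∧ ∀ t, p ^ k • x ≠ φ t} +
      Nat.card {x : G // p ^ k • x = 0} * Nat.card {t : T // p • t = 0} =
    Nat.card {x : G // p ^ (k + 1) • x = 0} := by
  choose s hs using fun t : {t : T // p • t = 0} => hdiv t.1 t.2
  have hsφ : ∀ t, p ^ k • φ (s t) = φ t.1 := fun t => by rw [← map_nsmul, hs]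
  have hbad : Nat.card {x : G // p ^ (k + 1) • x = 0 ∧ ¬ ∀ t, p ^ k • x ≠ φ t} =
      Nat.card {x : G // p ^ k • x = 0} * Nat.card {t : T // p • t = 0} := by
    rw [← Nat.card_prod]
    symm
    refine Nat.card_congr (Equiv.ofBijective
      (fun q => ⟨q.1.1 + φ (s q.2), ?_, ?_⟩) ⟨?_, ?_⟩)
    · rw [smul_add, pow_succ', mul_smul, mul_smul, q.1.2, hsφ, ← map_nsmul, q.2.2]
      simp
    · push Not
      exact ⟨q.2.1, by rw [smul_add, q.1.2, hsφ, zero_add]⟩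
    · rintro ⟨x, t⟩ ⟨y, u⟩ h
      have h1 : x.1 + φ (s t) = y.1 + φ (s u) := congrArg Subtype.val h
      have h2 := congrArg (p ^ k • ·) h1
      simp only [smul_add, x.2, y.2, hsφ, zero_add] at h2
      obtain rfl : t = u := Subtype.ext (hφ h2)
      exact Prod.ext (Subtype.ext (add_right_cancel h1)) rfl
    · rintro ⟨x, hx, hx'⟩
      push Not at hx'
      obtain ⟨t, ht⟩ := hx'
      have htp : p • t = 0 := hφ (by
        rw [map_nsmul, ← ht, smul_smul, ← pow_succ', hx, map_zero])
      refine ⟨(⟨x - φ (s ⟨t, htp⟩), ?_⟩, ⟨t, htp⟩), ?_⟩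
      · rw [smul_sub, hsφ, ht, sub_self]
      · exact Subtype.ext (sub_add_cancel _ _)
  rw [← hbad, ← Nat.card_sum]
  refine Nat.card_congr ?_
  exact (((Equiv.subtypeSubtypeEquivSubtypeInter _ _).symm.sumCongr
    (Equiv.subtypeSubtypeEquivSubtypeInter _ _).symm).trans (Equiv.sumCompl _))

lemma coprod_zmod_injective_iff {p : ℕ} (hp : p.Prime) (k : ℕ) (φ : T →+ G)
    (ψ : ZMod (p ^ (k + 1)) →+ G) :
    Function.Injective (φ.coprod ψ) ↔
      Function.Injective φ ∧ ∀ t, p ^ k • ψ 1 ≠ φ t := by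
  constructor
  · intro h
    refine ⟨fun t u htu => ?_, fun t ht => ?_⟩
    · exact congrArg Prod.fst (@h (t, 0) (u, 0) (by simpa using htu))
    · have h0 : ((t, 0) : T × ZMod (p ^ (k + 1))) = (0, p ^ k • 1) := h (by
        rw [AddMonoidHom.coprod_apply, AddMonoidHom.coprod_apply, map_nsmul, ht]
        simp)
      have h1 : ((p ^ k : ℕ) : ZMod (p ^ (k + 1))) = 0 := by
        have := congrArg Prod.snd h0
        simpa using this.symm
      rw [ZMod.natCast_eq_zero_iff, Nat.pow_dvd_pow_iff_le_right hp.one_lt] at h1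
      omega
  · rintro ⟨hφ, hψ⟩
    rw [injective_iff_map_eq_zero]
    rintro ⟨t, z⟩ h
    rw [AddMonoidHom.coprod_apply] at h
    dsimp only at h
    by_cases hz : z = 0
    · subst hz
      rw [map_zero, add_zero] at h
      rw [hφ (h.trans φ.map_zero.symm)]
      rfl
    · obtain ⟨c, hc⟩ := exists_zsmul_eq_prime_pow hp k hz
      exfalso
      apply hψ (-(c • t))
      have h1 : (p : ZMod (p ^ (k + 1))) ^ k = p ^ k • 1 := by simp
      rw [← map_nsmul, ← h1, ← hc, map_zsmul, eq_neg_of_add_eq_zero_right h, map_neg, map_zsmul,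
        smul_neg]

/-- The homomorphism out of `ℤ/n` sending `1` to a given element killed by `n`. -/
noncomputable def zmodHom (n : ℕ) (x : G) (hx : n • x = 0) : ZMod n →+ G :=
  ZMod.lift n ⟨zmultiplesHom G x, by simpa using hx⟩

lemma zmodHom_one (n : ℕ) (x : G) (hx : n • x = 0) : zmodHom n x hx 1 = x := by
  have := ZMod.lift_coe n ⟨zmultiplesHom G x, by simpa using hx⟩ 1
  simpa [zmodHom] using this

lemma zmodHom_map_one (n : ℕ) (ψ : ZMod n →+ G) (hψ : n • ψ 1 = 0) : zmodHom n (ψ 1) hψ = ψ := by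
  refine AddMonoidHom.ext fun z => ?_
  obtain ⟨a, rfl⟩ := ZMod.intCast_surjective z
  rw [← zsmul_one, map_zsmul, map_zsmul, zmodHom_one]

/-- The number of injective homomorphisms. -/
noncomputable def injCard (T G : Type*) [AddCommGroup T] [AddCommGroup G] : ℕ :=
  Nat.card {φ : T →+ G // Function.Injective φ}

lemma injCard_congr (e : T ≃+ U) : injCard T G = injCard U G :=
  Nat.card_congr ((e.addMonoidHomCongrLeftEquiv).subtypeEquiv fun φ => by
    simp)

lemma injCard_prod_zmod {p : ℕ} (hp : p.Prime) (k : ℕ) [Finite T] [Finite G]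
    (hdiv : ∀ t : T, p • t = 0 → ∃ s : T, p ^ k • s = t) :
    (injCard (T × ZMod (p ^ (k + 1))) G : ℚ) = injCard T G *
      ((Nat.card {x : G // p ^ (k + 1) • x = 0} : ℚ) -
        Nat.card {x : G // p ^ k • x = 0} * Nat.card {t : T // p • t = 0}) := by
  have e : (Σ φ : {φ : T →+ G // Function.Injective φ},
      {x : G // p ^ (k + 1) • x = 0 ∧ ∀ t, p ^ k • x ≠ φ.1 t}) ≃
      {ψ : T × ZMod (p ^ (k + 1)) →+ G // Function.Injective ψ} := by
    refine Equiv.ofBijective (fun q => ⟨q.1.1.coprod (zmodHom _ q.2.1 q.2.2.1), ?_⟩) ⟨?_, ?_⟩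
    · rw [coprod_zmod_injective_iff hp, zmodHom_one]
      exact ⟨q.1.2, q.2.2.2⟩
    · rintro ⟨⟨φ, hφ⟩, x, hx, hx'⟩ ⟨⟨θ, hθ⟩, y, hy, hy'⟩ h
      have h0 := congrArg Subtype.val h
      obtain rfl : φ = θ := AddMonoidHom.ext fun t => by
        simpa using DFunLike.congr_fun h0 (t, 0)
      obtain rfl : x = y := by
        simpa [zmodHom_one] using DFunLike.congr_fun h0 (0, 1)
      rfl
    · rintro ⟨ψ, hψ⟩
      have hcop : (ψ.comp (AddMonoidHom.inl T _)).coprod (ψ.comp (AddMonoidHom.inr T _)) = ψ :=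
        AddMonoidHom.coprod_unique ψ
      have h := (coprod_zmod_injective_iff hp k _ _).1 (hcop.symm ▸ hψ)
      have hone : p ^ (k + 1) • (1 : ZMod (p ^ (k + 1))) = 0 := by
        rw [nsmul_one, ZMod.natCast_self]
      refine ⟨⟨⟨_, h.1⟩, _, ?_, h.2⟩, Subtype.ext ?_⟩
      · rw [← map_nsmul, hone, map_zero]
      · dsimp only
        rw [zmodHom_map_one, hcop]
  have hfin : Finite (T →+ G) := Finite.of_injective _ DFunLike.coe_injective
  have hfib : ∀ φ : {φ : T →+ G // Function.Injective φ},
      (Nat.card {x : G // p ^ (k + 1) • x = 0 ∧ ∀ t, p ^ k • x ≠ φ.1 t} : ℚ) =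
      (Nat.card {x : G // p ^ (k + 1) • x = 0} : ℚ) -
        Nat.card {x : G // p ^ k • x = 0} * Nat.card {t : T // p • t = 0} := fun φ => by
    rw [eq_sub_iff_add_eq]
    exact_mod_cast card_extension_add p k hdiv φ.1 φ.2
  have : Fintype {φ : T →+ G // Function.Injective φ} := Fintype.ofFinite _
  rw [injCard, ← Nat.card_congr e, Nat.card_sigma, Nat.cast_sum,
    Finset.sum_congr rfl fun φ _ => hfib φ, Finset.sum_const, nsmul_eq_mul, Finset.card_univ,
    ← Nat.card_eq_fintype_card, injCard]

/-- Injections `T → G` are counted by their image and an automorphism of `T`. -/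
lemma injCard_eq_card_subgroup_mul [Finite T] :
    injCard T G = Nat.card {H : AddSubgroup G // Nonempty (H ≃+ T)} * injCard T T := by
  rw [injCard, injCard, ← Nat.card_prod]
  symm
  let e (H : {H : AddSubgroup G // Nonempty (H ≃+ T)}) : H.1 ≃+ T := H.2.some
  refine Nat.card_congr (Equiv.ofBijective
    (fun q => ⟨q.1.1.subtype.comp ((e q.1).symm.toAddMonoidHom.comp q.2.1), ?_⟩) ⟨?_, ?_⟩)
  · exact Subtype.val_injective.comp ((e q.1).symm.injective.comp q.2.2)
  · rintro ⟨H, φ, hφ⟩ ⟨K, θ, hθ⟩ h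
    have h0 := congrArg Subtype.val h
    have hrange : ∀ (H : {H : AddSubgroup G // Nonempty (H ≃+ T)}) (φ : T →+ T),
        Function.Injective φ →
        (H.1.subtype.comp ((e H).symm.toAddMonoidHom.comp φ)).range = H.1 := by
      intro H φ hφ
      have hs := Finite.injective_iff_surjective.1 hφ
      rw [AddMonoidHom.range_comp, AddMonoidHom.range_eq_top.2, ← AddMonoidHom.range_eq_map,
        AddSubgroup.range_subtype]
      exact (e H).symm.surjective.comp hs
    obtain rfl : H = K := Subtype.ext (by
      rw [← hrange H φ hφ, ← hrange K θ hθ]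
      exact congrArg AddMonoidHom.range h0)
    obtain rfl : φ = θ := AddMonoidHom.ext fun t =>
      (e H).symm.injective (Subtype.val_injective (DFunLike.congr_fun h0 t))
    rfl
  · rintro ⟨ψ, hψ⟩
    let H : {H : AddSubgroup G // Nonempty (H ≃+ T)} :=
      ⟨ψ.range, ⟨(AddMonoidHom.ofInjective hψ).symm⟩⟩
    refine ⟨(H, ⟨(e H).toAddMonoidHom.comp ψ.rangeRestrict, ?_⟩), ?_⟩
    · exact (e H).injective.comp (AddMonoidHom.rangeRestrict_injective_iff.2 hψ)
    · ext t
      change (((e H).symm ((e H) (ψ.rangeRestrict t)) : H.1) : G) = ψ t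
      rw [AddEquiv.symm_apply_apply]
      rfl

/-- Splitting off the last coordinate of a finite product of groups. -/
def initLastAddEquiv (m : ℕ) (A : ℕ → Type*) [∀ j, AddCommGroup (A j)] :
    (∀ j : Fin (m + 1), A j) ≃+ (∀ j : Fin m, A j) × A m where
  toFun x := (fun j => x j.castSucc, x (Fin.last m))
  invFun y := Fin.snoc (α := fun j : Fin (m + 1) => A j) y.1 y.2
  left_inv x := Fin.snoc_init_self x
  right_inv y := Prod.ext
    (funext fun j => Fin.snoc_castSucc (α := fun j : Fin (m + 1) => A j) y.2 y.1 j)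
    (Fin.snoc_last (α := fun j : Fin (m + 1) => A j) y.2 y.1)
  map_add' _ _ := rfl

end InjectiveHoms

lemma injCard_pi {p : ℕ} (hp : p.Prime) {f g : ℕ → ℕ} (hg : Antitone g) (n m : ℕ)
    (hpos : ∀ j < m, 0 < g j) :
    (injCard (∀ j : Fin m, ZMod (p ^ g j)) (∀ i : Fin n, ZMod (p ^ f i)) : ℚ) =
      ∏ j ∈ Finset.range m, ((p : ℚ) ^ (∑ i ∈ Finset.range n, min (g j) (f i)) -
        (p : ℚ) ^ (∑ i ∈ Finset.range n, min (g j - 1) (f i)) * (p : ℚ) ^ j) := by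
  have hne : ∀ (h : ℕ → ℕ) (i : ℕ), NeZero (p ^ h i) := fun h i => ⟨(pow_pos hp.pos _).ne'⟩
  induction m with
  | zero =>
    have : Unique {φ : (∀ j : Fin 0, ZMod (p ^ g j)) →+ (∀ i : Fin n, ZMod (p ^ f i)) //
        Function.Injective φ} :=
      ⟨⟨⟨0, fun x y _ => Subsingleton.elim x y⟩⟩, fun φ => Subtype.ext (AddMonoidHom.ext fun x => by
        rw [Subsingleton.elim x 0, map_zero, map_zero])⟩
    rw [injCard, Nat.card_unique]
    simp
  | succ m ih =>
    rw [Finset.prod_range_succ, ← ih fun j hj => hpos j (by omega),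
      injCard_congr (initLastAddEquiv m fun j => ZMod (p ^ g j))]
    obtain ⟨k, hk⟩ : ∃ k, g m = k + 1 := ⟨g m - 1, by have := hpos m (by omega); omega⟩
    have hlt : ∀ j < m, k < g j := fun j hj => by have := hg hj.le; omega
    have htor : Nat.card {t : ∀ j : Fin m, ZMod (p ^ g j) // p • t = 0} = p ^ m := by
      have h := card_torsion_pi hp m g 1
      rw [pow_one, Finset.sum_congr rfl fun j hj => min_eq_left
        (show 1 ≤ g j by have := hlt j (Finset.mem_range.1 hj); omega)] at h
      simpa using h
    rw [hk, injCard_prod_zmod hp k (exists_pow_nsmul_eq_pi hp hlt), card_torsion_pi hp,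
      card_torsion_pi hp, htor, Nat.add_sub_cancel]
    push_cast
    rfl

section Partitions

lemma IsPartition.le_iff_lt_conj {f : ℕ → ℕ} (hf : IsPartition f) {k : ℕ} (hk : 1 ≤ k) (i : ℕ) :
    k ≤ f i ↔ i < conj f k := by
  obtain ⟨hanti, N, hN⟩ := hf
  have hex : ∃ i, f i < k := ⟨N, by rw [hN N le_rfl]; omega⟩
  have key : ∀ i, k ≤ f i ↔ i < Nat.find hex := fun i => by
    rw [Nat.lt_find_iff]
    exact ⟨fun h a ha => not_lt.2 (h.trans (hanti ha)), fun h => not_lt.1 (h i le_rfl)⟩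
  have hc : conj f k = Nat.find hex := by
    rw [conj, Nat.card_congr ((Equiv.subtypeEquivRight key).trans Fin.equivSubtype.symm),
      Nat.card_fin]
  rw [hc, key]

lemma IsPartition.conj_le {f : ℕ → ℕ} (hf : IsPartition f) {n : ℕ} (hn : ∀ i, n ≤ i → f i = 0)
    {k : ℕ} (hk : 1 ≤ k) : conj f k ≤ n := by
  by_contra! h
  have := (hf.le_iff_lt_conj hk n).2 h
  rw [hn n le_rfl] at this
  omega

lemma IsPartition.conj_mono {f g : ℕ → ℕ} (hf : IsPartition f) (hg : IsPartition g)
    (hsub : ∀ i, g i ≤ f i) {k : ℕ} (hk : 1 ≤ k) : conj g k ≤ conj f k := by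
  by_contra! h
  have := (hg.le_iff_lt_conj hk _).2 h
  exact lt_irrefl _ ((hf.le_iff_lt_conj hk _).1 (this.trans (hsub _)))

lemma IsPartition.conj_succ_le {f : ℕ → ℕ} (hf : IsPartition f) {k : ℕ} (hk : 1 ≤ k) :
    conj f (k + 1) ≤ conj f k := by
  by_contra! h
  have := (hf.le_iff_lt_conj (by omega) _).2 h
  exact lt_irrefl _ ((hf.le_iff_lt_conj hk _).1 (by omega))

/-- Summation over a Young diagram by rows or by columns. -/
lemma IsPartition.sum_rows_eq_sum_columns {M : Type*} [AddCommMonoid M] {f : ℕ → ℕ}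
    (hf : IsPartition f) {n : ℕ} (hn : ∀ i, n ≤ i → f i = 0) {K : ℕ} (hK : f 0 ≤ K)
    (w : ℕ → ℕ → M) :
    ∑ i ∈ Finset.range n, ∑ k ∈ Finset.Icc 1 (f i), w i k =
      ∑ k ∈ Finset.Icc 1 K, ∑ i ∈ Finset.range (conj f k), w i k := by
  refine Finset.sum_comm' fun i k => ?_
  simp only [Finset.mem_range, Finset.mem_Icc]
  constructor
  · rintro ⟨-, hk, hki⟩
    exact ⟨(hf.le_iff_lt_conj hk i).1 hki, hk, hki.trans ((hf.1 (Nat.zero_le i)).trans hK)⟩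
  · rintro ⟨hi, hk, -⟩
    exact ⟨hi.trans_le (hf.conj_le hn hk), hk, (hf.le_iff_lt_conj hk i).2 hi⟩

lemma IsPartition.sum_min {f : ℕ → ℕ} (hf : IsPartition f) {n : ℕ}
    (hn : ∀ i, n ≤ i → f i = 0) (a : ℕ) :
    ∑ i ∈ Finset.range n, min a (f i) = ∑ k ∈ Finset.Icc 1 a, conj f k := by
  have h : ∀ i ∈ Finset.range n,
      min a (f i) = ∑ k ∈ Finset.Icc 1 a, if i < conj f k then 1 else 0 := by
    intro i _
    rw [← Finset.card_filter]
    have : (Finset.Icc 1 a).filter (fun k => i < conj f k) = Finset.Icc 1 (min a (f i)) := by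
      ext k
      simp only [Finset.mem_filter, Finset.mem_Icc, le_min_iff]
      constructor
      · rintro ⟨⟨h1, h2⟩, h3⟩
        exact ⟨h1, h2, (hf.le_iff_lt_conj h1 i).2 h3⟩
      · rintro ⟨h1, h2, h3⟩
        exact ⟨⟨h1, h2⟩, (hf.le_iff_lt_conj h1 i).1 h3⟩
    rw [this, Nat.card_Icc, Nat.add_sub_cancel]
  rw [Finset.sum_congr rfl h, Finset.sum_comm]
  refine Finset.sum_congr rfl fun k hk => ?_
  have hle := hf.conj_le hn (Finset.mem_Icc.1 hk).1
  rw [← Finset.card_filter]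
  have : (Finset.range n).filter (fun i => i < conj f k) = Finset.range (conj f k) := by
    ext i
    simp only [Finset.mem_filter, Finset.mem_range]
    omega
  rw [this, Finset.card_range]

lemma IsPartition.nstat_eq {f : ℕ → ℕ} (hf : IsPartition f) {K : ℕ} (hK : f 0 ≤ K) :
    nstat f = ∑ k ∈ Finset.Icc 1 K, (conj f k).choose 2 := by
  obtain ⟨n, hn⟩ := hf.2
  have hsupp : Function.support (fun i => i * f i) ⊆ (Finset.range n : Set ℕ) := by
    intro i hi
    by_contra h
    simp only [Finset.coe_range, Set.mem_Iio, not_lt] at h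
    exact hi (by simp [hn i h])
  rw [nstat, finsum_eq_sum_of_support_subset _ hsupp]
  have h := hf.sum_rows_eq_sum_columns hn hK fun i _ => i
  simp only [Finset.sum_const, Nat.card_Icc, Nat.add_sub_cancel, smul_eq_mul,
    Finset.sum_range_id, ← Nat.choose_two_right] at h
  rw [← h]
  exact Finset.sum_congr rfl fun i _ => mul_comm _ _

lemma add_choose_two (a d : ℕ) : (a + d).choose 2 = a.choose 2 + d.choose 2 + a * d := by
  induction d with
  | zero => simp
  | succ d ih =>
    rw [← add_assoc, Nat.choose_succ_succ' (a + d) 1, Nat.choose_succ_succ' d 1, ih]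
    simp only [Nat.choose_one_right]
    ring

/-- The exponents of `p` in the two counting formulas agree. -/
lemma nstat_sub_add_sum_conj {f g : ℕ → ℕ} (hf : IsPartition f) (hg : IsPartition g)
    (hsub : ∀ i, g i ≤ f i) {m : ℕ} (hm : ∀ i, m ≤ i → g i = 0) :
    nstat f - nstat g + ∑ j ∈ Finset.range m, ∑ k ∈ Finset.Icc 1 (g j), conj g k =
      (∑ k ∈ Finset.Icc 1 (f 0), (conj f k - conj g k).choose 2) +
        ∑ j ∈ Finset.range m, ∑ k ∈ Finset.Icc 1 (g j), conj f k := by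
  have hfg := hsub 0
  have hnn : nstat g ≤ nstat f := by
    rw [hf.nstat_eq le_rfl, hg.nstat_eq hfg]
    exact Finset.sum_le_sum fun k hk =>
      Nat.choose_le_choose 2 (hf.conj_mono hg hsub (Finset.mem_Icc.1 hk).1)
  have key : nstat f + ∑ j ∈ Finset.range m, ∑ k ∈ Finset.Icc 1 (g j), conj g k =
      nstat g + ((∑ k ∈ Finset.Icc 1 (f 0), (conj f k - conj g k).choose 2) +
        ∑ j ∈ Finset.range m, ∑ k ∈ Finset.Icc 1 (g j), conj f k) := by
    rw [hg.sum_rows_eq_sum_columns hm hfg, hg.sum_rows_eq_sum_columns hm hfg,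
      hf.nstat_eq le_rfl, hg.nstat_eq hfg]
    simp only [← Finset.sum_add_distrib, Finset.sum_const, Finset.card_range, smul_eq_mul]
    refine Finset.sum_congr rfl fun k hk => ?_
    obtain ⟨d, hd⟩ := Nat.exists_eq_add_of_le (hf.conj_mono hg hsub (Finset.mem_Icc.1 hk).1)
    rw [hd, add_choose_two, Nat.add_sub_cancel_left]
    ring
  omega

lemma prod_Ico_mul_phiPoch {F : Type*} [Field F] (u : F) {b a L : ℕ} (hba : b ≤ a) (haL : a ≤ L) :
    (∏ j ∈ Finset.Ico b a, (1 - u ^ (L - j))) * phiPoch u (L - a) = phiPoch u (L - b) := by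
  induction a, hba using Nat.le_induction with
  | base => simp
  | succ a hba ih =>
    rw [← ih (by omega), Finset.prod_Ico_succ_top hba, mul_assoc]
    congr 1
    obtain ⟨c, rfl⟩ : ∃ c, L = a + c + 1 := ⟨L - a - 1, by omega⟩
    rw [show a + c + 1 - a = c + 1 by omega, show a + c + 1 - (a + 1) = c by omega, phiPoch,
      phiPoch, Finset.prod_Icc_succ_top (by omega), mul_comm]

/-- Products over the rows of `g`, grouped by row length. -/
lemma IsPartition.prod_rows_eq {M : Type*} [CommMonoid M] {g : ℕ → ℕ} (hg : IsPartition g) {m : ℕ}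
    (hm : HasLength g m) {K : ℕ} (hK : g 0 ≤ K) (w : ℕ → ℕ → M) :
    ∏ j ∈ Finset.range m, w (g j) j =
      ∏ k ∈ Finset.Icc 1 K, ∏ j ∈ Finset.Ico (conj g (k + 1)) (conj g k), w k j := by
  have hmaps : ∀ j ∈ Finset.range m, g j ∈ Finset.Icc 1 K := fun j hj =>
    Finset.mem_Icc.2 ⟨hm.1 j (Finset.mem_range.1 hj), (hg.1 (Nat.zero_le j)).trans hK⟩
  rw [← Finset.prod_fiberwise_of_maps_to hmaps]
  refine Finset.prod_congr rfl fun k hk => ?_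
  have hk1 := (Finset.mem_Icc.1 hk).1
  have hset : (Finset.range m).filter (fun j => g j = k) =
      Finset.Ico (conj g (k + 1)) (conj g k) := by
    ext j
    have h1 := hg.le_iff_lt_conj hk1 j
    have h2 := hg.le_iff_lt_conj (show 1 ≤ k + 1 by omega) j
    have h3 := hg.conj_le hm.2 hk1
    simp only [Finset.mem_filter, Finset.mem_range, Finset.mem_Ico]
    omega
  rw [← hset]
  exact Finset.prod_congr rfl fun j hj => by rw [(Finset.mem_filter.1 hj).2]

lemma one_sub_inv_pow_ne_zero {P : ℚ} (hP : 1 < P) {r : ℕ} (hr : r ≠ 0) : 1 - P⁻¹ ^ r ≠ 0 :=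
  (sub_pos.2 (pow_lt_one₀ (by positivity) (inv_lt_one_of_one_lt₀ hP) hr)).ne'

lemma phiPoch_inv_ne_zero {P : ℚ} (hP : 1 < P) (r : ℕ) : phiPoch P⁻¹ r ≠ 0 :=
  Finset.prod_ne_zero_iff.2 fun i hi =>
    one_sub_inv_pow_ne_zero hP (by have := Finset.mem_Icc.1 hi; omega)

lemma prod_gauss_mul_prod {P : ℚ} (hP : 1 < P) {f g : ℕ → ℕ} (hf : IsPartition f)
    (hg : IsPartition g) (hsub : ∀ i, g i ≤ f i) {m : ℕ} (hm : HasLength g m) :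
    (∏ k ∈ Finset.Icc 1 (f 0),
      gauss P⁻¹ ((conj f k : ℤ) - (conj g (k + 1) : ℤ))
        ((conj g k : ℤ) - (conj g (k + 1) : ℤ))) *
      ∏ j ∈ Finset.range m, (1 - P⁻¹ ^ (conj g (g j) - j)) =
    ∏ j ∈ Finset.range m, (1 - P⁻¹ ^ (conj f (g j) - j)) := by
  rw [hg.prod_rows_eq hm (hsub 0) fun k j => 1 - P⁻¹ ^ (conj g k - j),
    hg.prod_rows_eq hm (hsub 0) fun k j => 1 - P⁻¹ ^ (conj f k - j), ← Finset.prod_mul_distrib]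
  refine Finset.prod_congr rfl fun k hk => ?_
  have hk1 := (Finset.mem_Icc.1 hk).1
  have hab := hg.conj_succ_le hk1
  have hbL := hf.conj_mono hg hsub hk1
  have h1 := prod_Ico_mul_phiPoch P⁻¹ hab hbL
  have h2 := prod_Ico_mul_phiPoch P⁻¹ hab (le_refl (conj g k))
  have h0 : phiPoch P⁻¹ (conj g k - conj g k) = 1 := by simp [phiPoch]
  rw [h0, mul_one] at h2
  have e1 : ((conj f k : ℤ) - (conj g (k + 1) : ℤ)).toNat = conj f k - conj g (k + 1) := by omega
  have e2 : ((conj g k : ℤ) - (conj g (k + 1) : ℤ)).toNat = conj g k - conj g (k + 1) := by omega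
  have e3 : ((conj f k : ℤ) - (conj g (k + 1) : ℤ) -
      ((conj g k : ℤ) - (conj g (k + 1) : ℤ))).toNat =
      conj f k - conj g k := by omega
  rw [gauss, if_pos (by omega), e1, e2, e3, h2, ← h1]
  have n1 := phiPoch_inv_ne_zero hP (conj g k - conj g (k + 1))
  have n2 := phiPoch_inv_ne_zero hP (conj f k - conj g k)
  rw [div_mul_eq_mul_div, div_eq_iff (mul_ne_zero n1 n2)]
  ring

/-- The factor contributed by one cyclic summand, in terms of the conjugate partition. -/
lemma IsPartition.pow_sum_min_sub {P : ℚ} (hP : P ≠ 0) {f : ℕ → ℕ} (hf : IsPartition f) {n : ℕ}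
    (hn : ∀ i, n ≤ i → f i = 0) {a j : ℕ} (ha : 1 ≤ a) (hj : j ≤ conj f a) :
    P ^ (∑ i ∈ Finset.range n, min a (f i)) -
        P ^ (∑ i ∈ Finset.range n, min (a - 1) (f i)) * P ^ j =
      P ^ (∑ k ∈ Finset.Icc 1 a, conj f k) * (1 - P⁻¹ ^ (conj f a - j)) := by
  obtain ⟨b, rfl⟩ : ∃ b, a = b + 1 := ⟨a - 1, by omega⟩
  obtain ⟨d, hd⟩ := Nat.exists_eq_add_of_le hj
  rw [hf.sum_min hn, hf.sum_min hn, Nat.add_sub_cancel, Finset.sum_Icc_succ_top (by omega), hd,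
    Nat.add_sub_cancel_left, inv_pow]
  field_simp
  ring

lemma prod_eq_pow_mul_sk_mul_prod {P : ℚ} (hP : 1 < P) {n m : ℕ} {f g : ℕ → ℕ}
    (hf : IsPartition f) (hg : IsPartition g) (hsub : ∀ i, g i ≤ f i)
    (hfl : HasLength f n) (hgl : HasLength g m) :
    ∏ j ∈ Finset.range m, (P ^ (∑ i ∈ Finset.range n, min (g j) (f i)) -
        P ^ (∑ i ∈ Finset.range n, min (g j - 1) (f i)) * P ^ j) =
      P ^ (nstat f - nstat g) * sk P⁻¹ f g *
      ∏ j ∈ Finset.range m, (P ^ (∑ i ∈ Finset.range m, min (g j) (g i)) -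
        P ^ (∑ i ∈ Finset.range m, min (g j - 1) (g i)) * P ^ j) := by
  have hP0 : P ≠ 0 := by positivity
  have hlt : ∀ j ∈ Finset.range m, 1 ≤ g j ∧ j ≤ conj g (g j) ∧ j ≤ conj f (g j) := by
    intro j hj
    have h1 : 1 ≤ g j := hgl.1 j (Finset.mem_range.1 hj)
    have h2 := ((hg.le_iff_lt_conj h1 j).1 le_rfl).le
    exact ⟨h1, h2, h2.trans (hf.conj_mono hg hsub h1)⟩
  rw [Finset.prod_congr rfl fun j hj =>
      hf.pow_sum_min_sub hP0 hfl.2 (hlt j hj).1 (hlt j hj).2.2,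
    Finset.prod_congr (s₁ := Finset.range m) rfl fun j hj =>
      hg.pow_sum_min_sub hP0 hgl.2 (hlt j hj).1 (hlt j hj).2.1,
    Finset.prod_mul_distrib, Finset.prod_mul_distrib, Finset.prod_pow_eq_pow_sum,
    Finset.prod_pow_eq_pow_sum, ← prod_gauss_mul_prod hP hf hg hsub hgl, sk]
  have hexp := congrArg (P ^ ·) (nstat_sub_add_sum_conj hf hg hsub hgl.2)
  simp only [pow_add] at hexp
  set S := ∑ k ∈ Finset.Icc 1 (f 0), (conj f k - conj g k).choose 2
  have hS : P⁻¹ ^ S * P ^ S = 1 := by rw [← mul_pow, inv_mul_cancel₀ hP0, one_pow]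
  set A := P ^ ∑ j ∈ Finset.range m, ∑ k ∈ Finset.Icc 1 (g j), conj f k
  set B := P ^ ∑ j ∈ Finset.range m, ∑ k ∈ Finset.Icc 1 (g j), conj g k
  have hA : A = P ^ (nstat f - nstat g) * P⁻¹ ^ S * B := by
    linear_combination (-A) * hS - P⁻¹ ^ S * hexp
  rw [hA]
  ring

lemma prod_self_ne_zero {P : ℚ} (hP : 1 < P) {m : ℕ} {g : ℕ → ℕ} (hg : IsPartition g)
    (hgl : HasLength g m) :
    ∏ j ∈ Finset.range m, (P ^ (∑ i ∈ Finset.range m, min (g j) (g i)) -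
      P ^ (∑ i ∈ Finset.range m, min (g j - 1) (g i)) * P ^ j) ≠ 0 := by
  have hP0 : P ≠ 0 := by positivity
  refine Finset.prod_ne_zero_iff.2 fun j hj => ?_
  have h1 : 1 ≤ g j := hgl.1 j (Finset.mem_range.1 hj)
  have h2 := (hg.le_iff_lt_conj h1 j).1 le_rfl
  rw [hg.pow_sum_min_sub hP0 hgl.2 h1 h2.le]
  exact mul_ne_zero (pow_ne_zero _ hP0) (one_sub_inv_pow_ne_zero hP (by omega))

end Partitions

/-- Let `p` be an odd prime and `μ ⊆ λ` partitions, with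
`G = ⊕_{i=1}^{l(λ)} ℤ/p^{λ_i}ℤ` and `T = ⊕_{j=1}^{l(μ)} ℤ/p^{μ_j}ℤ`.  The number of
subgroups `H ≤ G` with `H ≅ T` equals `p^{n(λ) - n(μ)} · sk_{λ/μ}(p⁻¹)` in `ℚ`. -/
theorem stmt8 (p : ℕ) (hp : p.Prime) (hodd : p ≠ 2) (n m : ℕ) (f g : ℕ → ℕ)
    (hf : IsPartition f) (hg : IsPartition g) (hsub : ∀ i, g i ≤ f i)
    (hfl : HasLength f n) (hgl : HasLength g m) :
    (Nat.card {H : AddSubgroup (∀ i : Fin n, ZMod (p ^ f (i : ℕ))) //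
        Nonempty (H ≃+ (∀ j : Fin m, ZMod (p ^ g (j : ℕ))))} : ℚ)
      = (p : ℚ) ^ (nstat f - nstat g) * sk ((p : ℚ)⁻¹) f g := by
  have hne : ∀ (h : ℕ → ℕ) (i : ℕ), NeZero (p ^ h i) := fun h i => ⟨(pow_pos hp.pos _).ne'⟩
  have hP : (1 : ℚ) < p := by exact_mod_cast hp.one_lt
  have hcount := congrArg (Nat.cast : ℕ → ℚ) (injCard_eq_card_subgroup_mul
    (T := ∀ j : Fin m, ZMod (p ^ g (j : ℕ))) (G := ∀ i : Fin n, ZMod (p ^ f (i : ℕ))))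
  rw [Nat.cast_mul, injCard_pi hp hg.1 n m hgl.1, injCard_pi hp hg.1 m m hgl.1,
    prod_eq_pow_mul_sk_mul_prod hP hf hg hsub hfl hgl] at hcount
  exact (mul_right_cancel₀ (prod_self_ne_zero hP hg hgl) hcount).symm

end EK
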